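/- Let $V(\psi_1)$ and $V(\psi_2)$ be irreducible finite-dimensional $\mathfrak{q}(n) \otimes A$-modules with disjoint supports. Then the tensor product $V(\psi_1) \otimes V(\psi_2)$ (a module via the diagonal action) is isomorphic either to $V(\psi_1 + \psi_2)$ or to $V(\psi_1+\psi_2) \oplus V(\psi_1+\psi_2)$. -/

import Mathlib

open Matrix

noncomputable section

variable (n : ℕ) (A : Type*) [CommRing A] [Algebra ℂ A]

/-- Square matrices of size `n+1` with entries in the commutative `ℂ`-algebra `A`. -/
abbrev QMat := Matrix (Fin (n + 1)) (Fin (n + 1)) A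

/-- The ambient space of pairs `(X, Y)` of matrices over `A`; a pair represents the
element of `𝔮(n) ⊗ A` with even component `X` and odd component `Y` (using the
identification of `𝔮(n) ⊗ A` with pairs of traceless `(n+1) × (n+1)` matrices over
`A`, where `(X, Y)` corresponds to the class of `[[X, Y], [Y, X]]`). -/
abbrev QPair := QMat n A × QMat n A

/-- `𝔮(n) ⊗ A`, realized as the space of pairs of traceless matrices over `A`. -/
def qA : Submodule ℂ (QPair n A) where
  carrier := {p | p.1.trace = 0 ∧ p.2.trace = 0}
  add_mem' := by
    intro p q hp hq
    exact ⟨by simp [hp.1, hq.1], by simp [hp.2, hq.2]⟩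
  zero_mem' := by simp
  smul_mem' := by
    intro c p hp
    exact ⟨by simp [hp.1], by simp [hp.2]⟩

/-- The Lie superbracket of `𝔮(n) ⊗ A` in the matrix-pair model: on even components it
is the commutator plus the anticommutator of the odd components (projected back to
traceless matrices), and on odd components it is given by the mixed commutators. -/
def qbr (p q : QPair n A) : QPair n A :=
  (p.1 * q.1 - q.1 * p.1 + p.2 * q.2 + q.2 * p.2 -
      (((n : ℂ) + 1)⁻¹ • (p.2 * q.2 + q.2 * p.2).trace) • (1 : QMat n A),
    p.1 * q.2 - q.2 * p.1 + p.2 * q.1 - q.1 * p.2)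

lemma qbr_mem (p q : QPair n A) : qbr n A p q ∈ qA n A := by
  have h1 : ((((n : ℂ) + 1)⁻¹ • (p.2 * q.2 + q.2 * p.2).trace) •
      (1 : QMat n A)).trace = (p.2 * q.2 + q.2 * p.2).trace := by
    rw [Matrix.trace_smul, Matrix.trace_one, smul_eq_mul, smul_mul_assoc]
    rw [show ((Fintype.card (Fin (n + 1)) : A)) = ((n + 1 : ℕ) : A) by simp]
    rw [← nsmul_eq_mul', ← Nat.cast_smul_eq_nsmul ℂ, smul_smul]
    rw [show (((n + 1 : ℕ) : ℂ)) = (n : ℂ) + 1 by push_cast; ring]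
    rw [inv_mul_cancel₀ (by
      exact_mod_cast Nat.cast_add_one_ne_zero (R := ℂ) n), one_smul]
  constructor
  · show (p.1 * q.1 - q.1 * p.1 + p.2 * q.2 + q.2 * p.2 -
      (((n : ℂ) + 1)⁻¹ • (p.2 * q.2 + q.2 * p.2).trace) • (1 : QMat n A)).trace = 0
    rw [Matrix.trace_sub, h1, Matrix.trace_add, Matrix.trace_add, Matrix.trace_sub,
      Matrix.trace_add, Matrix.trace_mul_comm p.1 q.1]
    ring
  · show (p.1 * q.2 - q.2 * p.1 + p.2 * q.1 - q.1 * p.2).trace = 0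
    rw [Matrix.trace_sub, Matrix.trace_add, Matrix.trace_sub,
      Matrix.trace_mul_comm p.1 q.2, Matrix.trace_mul_comm p.2 q.1]
    ring

/-- An element of the matrix-pair model is even if its odd component vanishes. -/
def IsEvenElt (p : QPair n A) : Prop := p.2 = 0

/-- An element of the matrix-pair model is odd if its even component vanishes. -/
def IsOddElt (p : QPair n A) : Prop := p.1 = 0

/-- Membership in `𝔥₀ ⊗ A`: even, with diagonal matrix component. -/
def InH0 (p : QPair n A) : Prop := p.2 = 0 ∧ p.1.IsDiag

/-- Membership in `𝔥₁ ⊗ A`: odd, with diagonal matrix component. -/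
def InH1 (p : QPair n A) : Prop := p.1 = 0 ∧ p.2.IsDiag

/-- Membership in `𝔥 ⊗ A`: both components diagonal. -/
def InH (p : QPair n A) : Prop := p.1.IsDiag ∧ p.2.IsDiag

/-- Membership in `𝔫⁺ ⊗ A`: both components strictly upper triangular. -/
def InNplus (p : QPair n A) : Prop :=
  ∀ i j : Fin (n + 1), j ≤ i → p.1 i j = 0 ∧ p.2 i j = 0

/-- Membership in `𝔮(n) ⊗ I` for an ideal `I ⊆ A`: all entries lie in `I`. -/
def EntriesIn (I : Ideal A) (p : QPair n A) : Prop :=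
  ∀ i j : Fin (n + 1), p.1 i j ∈ I ∧ p.2 i j ∈ I

/-- `𝔥₀ ⊗ A` as a subspace of the matrix-pair model of `𝔮(n) ⊗ A`: even diagonal
traceless pairs. -/
def h0A : Submodule ℂ (QPair n A) where
  carrier := {p | p.2 = 0 ∧ p.1.IsDiag ∧ p.1.trace = 0}
  add_mem' := by
    intro p q hp hq
    exact ⟨by simp [hp.1, hq.1], hp.2.1.add hq.2.1, by simp [hp.2.2, hq.2.2]⟩
  zero_mem' := ⟨rfl, Matrix.isDiag_zero, by simp⟩
  smul_mem' := by
    intro c p hp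
    exact ⟨by simp [hp.1], hp.2.1.smul c, by simp [hp.2.2]⟩

lemma h0A_le_qA : h0A n A ≤ qA n A := by
  intro p hp
  exact ⟨hp.2.2, by simp [hp.1]⟩

/-- The raw data of an action of `𝔮(n) ⊗ A` on a `ℤ₂`-graded vector space `M`: an
action map and the parity involution `P` of `M`. -/
structure QAct (M : Type*) [AddCommGroup M] [Module ℂ M] where
  act : ↥(qA n A) →ₗ[ℂ] M →ₗ[ℂ] M
  P : M →ₗ[ℂ] M

variable {M : Type*} [AddCommGroup M] [Module ℂ M]

/-- The data `ρ` is a representation of the Lie superalgebra `𝔮(n) ⊗ A`: `P` is an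
involution, commuting (resp. anticommuting) with the action of even (resp. odd)
elements, and the bracket acts by the supercommutator. -/
def QAct.IsRep (ρ : QAct n A M) : Prop :=
  (ρ.P ∘ₗ ρ.P = LinearMap.id) ∧
  (∀ x : ↥(qA n A), IsEvenElt n A ↑x → ρ.P ∘ₗ ρ.act x = ρ.act x ∘ₗ ρ.P) ∧
  (∀ x : ↥(qA n A), IsOddElt n A ↑x → ρ.P ∘ₗ ρ.act x = -(ρ.act x ∘ₗ ρ.P)) ∧
  (∀ x y : ↥(qA n A), (IsEvenElt n A ↑x ∨ IsEvenElt n A ↑y) →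
    ρ.act ⟨qbr n A ↑x ↑y, qbr_mem n A _ _⟩ = ρ.act x ∘ₗ ρ.act y - ρ.act y ∘ₗ ρ.act x) ∧
  (∀ x y : ↥(qA n A), IsOddElt n A ↑x → IsOddElt n A ↑y →
    ρ.act ⟨qbr n A ↑x ↑y, qbr_mem n A _ _⟩ = ρ.act x ∘ₗ ρ.act y + ρ.act y ∘ₗ ρ.act x)

/-- A graded submodule: stable under the action and under the parity involution. -/
def QAct.Invt (ρ : QAct n A M) (N : Submodule ℂ M) : Prop :=
  (∀ x : ↥(qA n A), ∀ m ∈ N, ρ.act x m ∈ N) ∧ ∀ m ∈ N, ρ.P m ∈ N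

/-- Irreducibility: `M ≠ 0` and the only graded invariant subspaces are `0`, `M`. -/
def QAct.Irred (ρ : QAct n A M) : Prop :=
  Nontrivial M ∧ ∀ N : Submodule ℂ M, QAct.Invt n A ρ N → N = ⊥ ∨ N = ⊤

/-- The `U(𝔮(n) ⊗ A)`-submodule of `M` generated by `v`: the smallest subspace
containing `v` and stable under the action. -/
def QAct.gen (ρ : QAct n A M) (v : M) : Submodule ℂ M :=
  sInf {N | v ∈ N ∧ ∀ x : ↥(qA n A), ∀ m ∈ N, ρ.act x m ∈ N}

/-- `v` is a highest weight vector of `ρ` with highest weight `ψ : 𝔥₀ ⊗ A → ℂ`: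
`v ≠ 0`, `v` generates `M` (i.e. `U(𝔮 ⊗ A)v = M`), `(𝔫⁺ ⊗ A)v = 0` and every element
of `𝔥₀ ⊗ A` acts on `v` by the scalar given by `ψ` (i.e. `U(𝔥₀ ⊗ A)v = ℂv`). -/
def QAct.IsHWVector (ρ : QAct n A M) (ψ : ↥(h0A n A) →ₗ[ℂ] ℂ) (v : M) : Prop :=
  v ≠ 0 ∧ QAct.gen n A ρ v = ⊤ ∧
  (∀ x : ↥(qA n A), InNplus n A ↑x → ρ.act x v = 0) ∧
  (∀ (p : QPair n A) (hp : p ∈ h0A n A),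
    ρ.act ⟨p, h0A_le_qA n A hp⟩ v = ψ ⟨p, hp⟩ • v)

/-- `ψ ∈ 𝓛(𝔥 ⊗ A)`: a functional on `𝔥₀ ⊗ A` vanishing on `𝔥₀ ⊗ I` for some
finite-codimensional ideal `I ⊆ A`. -/
def LFun (ψ : ↥(h0A n A) →ₗ[ℂ] ℂ) : Prop :=
  ∃ I : Ideal A, FiniteDimensional ℂ (A ⧸ I) ∧
    ∀ x : ↥(h0A n A), EntriesIn n A I ↑x → ψ x = 0

open TensorProduct

/-- The even component of an element of `𝔮(n) ⊗ A` (projection killing the odd part). -/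
def evenPartL : ↥(qA n A) →ₗ[ℂ] ↥(qA n A) where
  toFun x := ⟨((x : QPair n A).1, 0), ⟨x.2.1, by simp⟩⟩
  map_add' x y := by ext <;> simp
  map_smul' c x := by ext <;> simp

/-- The odd component of an element of `𝔮(n) ⊗ A`. -/
def oddPartL : ↥(qA n A) →ₗ[ℂ] ↥(qA n A) where
  toFun x := ⟨(0, (x : QPair n A).2), ⟨by simp, x.2.2⟩⟩
  map_add' x y := by ext <;> simp
  map_smul' c x := by ext <;> simp

variable {M1 M2 : Type*} [AddCommGroup M1] [Module ℂ M1]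
  [AddCommGroup M2] [Module ℂ M2]

/-- The action of `x ∈ 𝔮(n) ⊗ A` on the tensor product of two graded modules, with
the super sign rule `x (m ⊗ m') = (x m) ⊗ m' + (-1)^{|x||m|} m ⊗ (x m')`, expressed
using the parity involution of the first factor and the even/odd components of `x`. -/
def tensAct (ρ1 : QAct n A M1) (ρ2 : QAct n A M2) (x : ↥(qA n A)) :
    M1 ⊗[ℂ] M2 →ₗ[ℂ] M1 ⊗[ℂ] M2 :=
  TensorProduct.map (ρ1.act x) LinearMap.id +
    TensorProduct.map LinearMap.id (ρ2.act (evenPartL n A x)) +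
    TensorProduct.map ρ1.P (ρ2.act (oddPartL n A x))

/-- The parity involution of the tensor product of two graded modules. -/
def tensP (ρ1 : QAct n A M1) (ρ2 : QAct n A M2) : M1 ⊗[ℂ] M2 →ₗ[ℂ] M1 ⊗[ℂ] M2 :=
  TensorProduct.map ρ1.P ρ2.P

/-- The annihilator in `A` of a `𝔮(n) ⊗ A`-module: the largest ideal `I` with
`(𝔮 ⊗ I) V = 0`. -/
def annA (ρ : QAct n A M) : Ideal A :=
  sSup {I : Ideal A | ∀ x : ↥(qA n A), EntriesIn n A I ↑x → ρ.act x = 0}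

/-- A bundled `ℤ₂`-graded `𝔮(n) ⊗ A`-module. -/
structure QModB (n : ℕ) (A : Type) [CommRing A] [Algebra ℂ A] where
  M : Type
  [i1 : AddCommGroup M]
  [i2 : Module ℂ M]
  ρ : QAct n A M

attribute [instance] QModB.i1 QModB.i2

variable {B : Type} [CommRing B] [Algebra ℂ B]

/-! ### Linear algebra: Schur, Burnside, slices -/

section LinAlg

variable {W U : Type*} [AddCommGroup W] [Module ℂ W] [AddCommGroup U] [Module ℂ U]

/-- A set of operators acts irreducibly. -/
def IrrSet (O : Set (Module.End ℂ W)) : Prop :=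
  ∀ N : Submodule ℂ W, (∀ a ∈ O, ∀ m ∈ N, a m ∈ N) → N = ⊥ ∨ N = ⊤

lemma schur_scalar [FiniteDimensional ℂ W] [Nontrivial W] {O : Set (Module.End ℂ W)}
    (hO : IrrSet O) (g : Module.End ℂ W) (hg : ∀ a ∈ O, ∀ m, g (a m) = a (g m)) :
    ∃ c : ℂ, ∀ m, g m = c • m := by
  obtain ⟨c, hc⟩ := Module.End.exists_eigenvalue g
  refine ⟨c, ?_⟩
  rcases hO (g.eigenspace c) (by
    intro a ha m hm
    rw [Module.End.mem_eigenspace_iff] at hm ⊢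
    rw [hg a ha, hm, map_smul]) with h | h
  · exact absurd h hc
  · intro m
    have : m ∈ g.eigenspace c := by rw [h]; trivial
    exact Module.End.mem_eigenspace_iff.1 this

lemma burnside_adjoin [FiniteDimensional ℂ W] [Nontrivial W] {O : Set (Module.End ℂ W)}
    (hO : IrrSet O) : Algebra.adjoin ℂ O = ⊤ := by
  have hsimple : IsSimpleModule (Algebra.adjoin ℂ O) W := by
    refine { toIsSimpleOrder := ?_ }
    refine { toNontrivial := inferInstance, eq_bot_or_eq_top := ?_ }
    intro N
    rcases hO (N.restrictScalars ℂ) (by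
      intro a ha m hm
      exact N.smul_mem (⟨a, Algebra.subset_adjoin ha⟩ : Algebra.adjoin ℂ O) hm) with h | h
    · left
      rw [eq_bot_iff]
      intro m hm
      have : m ∈ N.restrictScalars ℂ := hm
      rw [h] at this
      exact this
    · right
      rw [eq_top_iff]
      intro m _
      have : m ∈ N.restrictScalars ℂ := by rw [h]; trivial
      exact this
  rw [eq_top_iff]
  intro g _
  let f : Module.End (Module.End (Algebra.adjoin ℂ O) W) W :=
    { toFun := g
      map_add' := map_add g
      map_smul' := by
        intro r m
        obtain ⟨c, hc⟩ := schur_scalar hO (r.restrictScalars ℂ) (by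
          intro a ha m
          exact r.map_smul (⟨a, Algebra.subset_adjoin ha⟩ : Algebra.adjoin ℂ O) m)
        have h1 : ∀ m, r • m = c • m := hc
        simp [h1] }
  obtain ⟨s, hs⟩ := Module.Finite.fg_top (R := ℂ) (M := W)
  obtain ⟨r, hr⟩ := jacobson_density f s
  have : g = (r : Module.End ℂ W) := by
    apply LinearMap.ext_on (s := (s : Set W)) hs
    intro m hm
    exact hr m hm
  rw [this]
  exact r.2

open TensorProduct

lemma burnside_left [FiniteDimensional ℂ W] [Nontrivial W] {O : Set (Module.End ℂ W)}
    (hO : IrrSet O) (S : Submodule ℂ (W ⊗[ℂ] U))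
    (hS : ∀ a ∈ O, ∀ t ∈ S, TensorProduct.map a LinearMap.id t ∈ S) (g : Module.End ℂ W) :
    ∀ t ∈ S, TensorProduct.map g LinearMap.id t ∈ S := by
  have hg : g ∈ Algebra.adjoin ℂ O := by rw [burnside_adjoin hO]; trivial
  induction hg using Algebra.adjoin_induction with
  | mem x hx => exact hS x hx
  | algebraMap r =>
    intro t ht
    have : TensorProduct.map (algebraMap ℂ (Module.End ℂ W) r) (LinearMap.id : U →ₗ[ℂ] U)
        = r • LinearMap.id := by
      ext; simp [TensorProduct.smul_tmul']
    rw [this]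
    exact S.smul_mem r ht
  | add x y _ _ hx hy =>
    intro t ht
    rw [TensorProduct.map_add_left]
    exact S.add_mem (hx t ht) (hy t ht)
  | mul x y _ _ hx hy =>
    intro t ht
    have : TensorProduct.map (x * y) (LinearMap.id : U →ₗ[ℂ] U) t
      = TensorProduct.map x LinearMap.id (TensorProduct.map y LinearMap.id t) := by
      rw [← LinearMap.comp_apply, ← TensorProduct.map_comp]; rfl
    rw [this]
    exact hx _ (hy t ht)

/-- slice by a functional on the right factor -/
def sliceR (f : U →ₗ[ℂ] ℂ) : W ⊗[ℂ] U →ₗ[ℂ] W :=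
  (TensorProduct.rid ℂ W).toLinearMap ∘ₗ TensorProduct.map LinearMap.id f

/-- slice by a functional on the left factor -/
def sliceL (f : W →ₗ[ℂ] ℂ) : W ⊗[ℂ] U →ₗ[ℂ] U :=
  (TensorProduct.lid ℂ U).toLinearMap ∘ₗ TensorProduct.map f LinearMap.id

@[simp] lemma sliceR_tmul (f : U →ₗ[ℂ] ℂ) (w : W) (u : U) :
    sliceR f (w ⊗ₜ[ℂ] u) = f u • w := by simp [sliceR]

@[simp] lemma sliceL_tmul (f : W →ₗ[ℂ] ℂ) (w : W) (u : U) :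
    sliceL f (w ⊗ₜ[ℂ] u) = f w • u := by simp [sliceL]

lemma sliceR_sep [FiniteDimensional ℂ U] (t : W ⊗[ℂ] U)
    (h : ∀ f : U →ₗ[ℂ] ℂ, sliceR f t = 0) : t = 0 := by
  let b := Module.finBasis ℂ U
  have key : ∀ t : W ⊗[ℂ] U, t = ∑ i, sliceR (b.coord i) t ⊗ₜ[ℂ] b i := by
    intro t
    induction t with
    | zero => simp
    | tmul w u =>
      conv_lhs => rw [← b.sum_repr u]
      rw [TensorProduct.tmul_sum]
      refine Finset.sum_congr rfl fun i _ => ?_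
      simp [TensorProduct.smul_tmul]
    | add x y hx hy =>
      conv_lhs => rw [hx, hy]
      simp [TensorProduct.add_tmul, Finset.sum_add_distrib]
  rw [key t]
  simp [h]

lemma sliceL_sep [FiniteDimensional ℂ W] (t : W ⊗[ℂ] U)
    (h : ∀ f : W →ₗ[ℂ] ℂ, sliceL f t = 0) : t = 0 := by
  let b := Module.finBasis ℂ W
  have key : ∀ t : W ⊗[ℂ] U, t = ∑ i, b i ⊗ₜ[ℂ] sliceL (b.coord i) t := by
    intro t
    induction t with
    | zero => simp
    | tmul w u =>
      conv_lhs => rw [← b.sum_repr w]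
      rw [TensorProduct.sum_tmul]
      refine Finset.sum_congr rfl fun i _ => ?_
      simp [TensorProduct.smul_tmul]
    | add x y hx hy =>
      conv_lhs => rw [hx, hy]
      simp [TensorProduct.tmul_add, Finset.sum_add_distrib]
  rw [key t]
  simp [h]

/-- The outer tensor product of irreducibles is irreducible. -/
lemma outer_irr [FiniteDimensional ℂ W] [Nontrivial W]
    {O : Set (Module.End ℂ W)} {O' : Set (Module.End ℂ U)}
    (hO : IrrSet O) (hO' : IrrSet O') (S : Submodule ℂ (W ⊗[ℂ] U))
    (hS : ∀ a ∈ O, ∀ t ∈ S, TensorProduct.map a LinearMap.id t ∈ S)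
    (hS' : ∀ a ∈ O', ∀ t ∈ S, TensorProduct.map LinearMap.id a t ∈ S) : S = ⊥ ∨ S = ⊤ := by
  by_cases hbot : S = ⊥
  · exact Or.inl hbot
  right
  obtain ⟨t, ht, ht0⟩ := (Submodule.ne_bot_iff S).1 hbot
  let R : Submodule ℂ U :=
    { carrier := {u | ∀ w : W, w ⊗ₜ[ℂ] u ∈ S}
      add_mem' := by
        intro u u' hu hu' w
        rw [TensorProduct.tmul_add]; exact S.add_mem (hu w) (hu' w)
      zero_mem' := by intro w; simp
      smul_mem' := by
        intro c u hu w
        rw [TensorProduct.tmul_smul]; exact S.smul_mem c (hu w) }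
  have hR : R = ⊥ ∨ R = ⊤ := by
    apply hO' R
    intro a ha u hu w
    simpa using hS' a ha _ (hu w)
  have hRtop : R = ⊤ := by
    refine hR.resolve_left ?_
    intro hRb
    apply ht0
    apply sliceL_sep
    intro f
    have : sliceL f t ∈ R := by
      intro w
      have h1 := burnside_left hO S hS (f.smulRight w) t ht
      have h2 : ∀ t : W ⊗[ℂ] U, TensorProduct.map (f.smulRight w) LinearMap.id t
          = w ⊗ₜ[ℂ] sliceL f t := by
        intro t
        induction t with
        | zero => simp
        | tmul w' u => simp [TensorProduct.smul_tmul]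
        | add x y hx hy => simp [hx, hy, TensorProduct.tmul_add]
      rwa [h2] at h1
    rw [hRb] at this
    exact this
  rw [eq_top_iff]
  intro t _
  induction t with
  | zero => exact S.zero_mem
  | tmul w u =>
    have : u ∈ R := by rw [hRtop]; trivial
    exact this w
  | add x y hx hy => exact S.add_mem (hx trivial) (hy trivial)

end LinAlg

section Abstract

open TensorProduct

lemma clifford_abstract {T : Type*} [AddCommGroup T] [Module ℂ T]
    (σ : Module.End ℂ T) (hσ : ∀ t, σ (σ t) = t) (G : Set (Module.End ℂ T))
    (hG : ∀ g ∈ G, (∀ t, σ (g t) = g (σ t)) ∨ (∀ t, σ (g t) = -g (σ t)))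
    (hfull : ∀ S : Submodule ℂ T, (∀ g ∈ G, ∀ t ∈ S, g t ∈ S) → (∀ t ∈ S, σ t ∈ S) →
      S = ⊥ ∨ S = ⊤)
    (N : Submodule ℂ T) (hN : ∀ g ∈ G, ∀ t ∈ N, g t ∈ N) (hbot : N ≠ ⊥) (htop : N ≠ ⊤) :
    (∃ K : Module.End ℂ T, (∀ t, K (K t) = t) ∧ (∀ g ∈ G, ∀ t, K (g t) = g (K t)) ∧
      (∀ t, K (σ t) = -σ (K t)) ∧ (∀ t, t ∈ N ↔ K t = t)) ∧
    (∀ N' : Submodule ℂ T, N' ≤ N → (∀ g ∈ G, ∀ t ∈ N', g t ∈ N') → N' = ⊥ ∨ N' = N) := by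
  have hcomap : ∀ S : Submodule ℂ T, (∀ g ∈ G, ∀ t ∈ S, g t ∈ S) →
      ∀ g ∈ G, ∀ t ∈ S.comap σ, g t ∈ S.comap σ := by
    intro S hS g hg t ht
    rw [Submodule.mem_comap] at ht ⊢
    rcases hG g hg with h | h
    · rw [h]; exact hS g hg _ ht
    · rw [h]; exact S.neg_mem (hS g hg _ ht)
  have hcompl : ∀ S : Submodule ℂ T, (∀ g ∈ G, ∀ t ∈ S, g t ∈ S) → S ≠ ⊥ → S ≠ ⊤ →
      IsCompl S (S.comap σ) := by
    intro S hS hSb hSt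
    constructor
    · rw [disjoint_iff]
      refine (hfull (S ⊓ S.comap σ) ?_ ?_).resolve_right ?_
      · intro g hg t ht
        exact ⟨hS g hg t ht.1, hcomap S hS g hg t ht.2⟩
      · intro t ht
        refine ⟨ht.2, ?_⟩
        show σ (σ t) ∈ S
        rw [hσ]; exact ht.1
      · intro h
        apply hSt
        rw [eq_top_iff, ← h]; exact inf_le_left
    · rw [codisjoint_iff]
      refine (hfull (S ⊔ S.comap σ) ?_ ?_).resolve_left ?_
      · intro g hg t ht
        obtain ⟨y, hy, z, hz, rfl⟩ := Submodule.mem_sup.1 ht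
        rw [map_add]
        exact Submodule.mem_sup.2 ⟨_, hS g hg y hy, _, hcomap S hS g hg z hz, rfl⟩
      · intro t ht
        obtain ⟨y, hy, z, hz, rfl⟩ := Submodule.mem_sup.1 ht
        rw [map_add]
        refine Submodule.mem_sup.2 ⟨σ z, hz, σ y, ?_, add_comm _ _⟩
        rw [Submodule.mem_comap, hσ]; exact hy
      · intro h
        apply hSb
        rw [eq_bot_iff, ← h]; exact le_sup_left
  have hc := hcompl N hN hbot htop
  have hdec : ∀ t, ∃ y ∈ N, ∃ z ∈ N.comap σ, t = y + z := by
    intro t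
    have : t ∈ N ⊔ N.comap σ := by rw [hc.sup_eq_top]; trivial
    obtain ⟨y, hy, z, hz, h⟩ := Submodule.mem_sup.1 this
    exact ⟨y, hy, z, hz, h.symm⟩
  have hzero : ∀ t, t ∈ N → t ∈ N.comap σ → t = 0 := by
    intro t h1 h2
    have : t ∈ N ⊓ N.comap σ := ⟨h1, h2⟩
    rw [hc.inf_eq_bot] at this
    exact this
  refine ⟨?_, ?_⟩
  · let π := N.projection (N.comap σ) hc
    let K : Module.End ℂ T := (2 : ℂ) • π - LinearMap.id
    have hK1 : ∀ y ∈ N, K y = y := by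
      intro y hy
      have : π y = y := Submodule.projection_apply_of_mem_left hc hy
      simp only [K, LinearMap.sub_apply, LinearMap.smul_apply, this, LinearMap.id_apply]
      rw [two_smul]; abel
    have hK2 : ∀ z ∈ N.comap σ, K z = -z := by
      intro y hy
      have : π y = 0 := (Submodule.projection_apply_eq_zero_iff hc).2 hy
      simp [K, this]
    refine ⟨K, ?_, ?_, ?_, ?_⟩
    · intro t
      obtain ⟨y, hy, z, hz, rfl⟩ := hdec t
      simp [hK1 y hy, hK2 z hz]
    · intro g hg t
      obtain ⟨y, hy, z, hz, rfl⟩ := hdec t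
      simp [hK1 y hy, hK2 z hz, hK1 _ (hN g hg y hy), hK2 _ (hcomap N hN g hg z hz)]
    · intro t
      obtain ⟨y, hy, z, hz, rfl⟩ := hdec t
      have h1 : K (σ y) = -σ y := hK2 _ (by rw [Submodule.mem_comap, hσ]; exact hy)
      have h2 : K (σ z) = σ z := hK1 _ hz
      simp only [map_add, h1, h2, hK1 y hy, hK2 z hz, map_neg]; abel
    · intro t
      refine ⟨hK1 t, ?_⟩
      obtain ⟨y, hy, z, hz, rfl⟩ := hdec t
      intro h
      rw [map_add, hK1 y hy, hK2 z hz, add_right_inj] at h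
      have : z = 0 := by
        have h3 : (2 : ℂ) • z = 0 := by rw [two_smul]; nth_rewrite 1 [← h]; simp
        simpa using h3
      rw [this, add_zero]; exact hy
  · intro N' hle hN'
    by_cases hb : N' = ⊥
    · exact Or.inl hb
    right
    have ht : N' ≠ ⊤ := by
      rintro rfl
      exact htop (top_le_iff.1 hle)
    have hc' := hcompl N' hN' hb ht
    refine le_antisymm hle ?_
    intro t htN
    have : t ∈ N' ⊔ N'.comap σ := by rw [hc'.sup_eq_top]; trivial
    obtain ⟨y, hy, z, hz, h⟩ := Submodule.mem_sup.1 this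
    have hz0 : z = 0 := by
      apply hzero
      · have : z = t - y := by rw [← h]; abel
        rw [this]; exact N.sub_mem htN (hle hy)
      · exact hle hz
    rw [← h, hz0, add_zero]; exact hy

variable {W U : Type*} [AddCommGroup W] [Module ℂ W] [AddCommGroup U] [Module ℂ U]

lemma sliceR_map (f : U →ₗ[ℂ] ℂ) (a : Module.End ℂ W) (t : W ⊗[ℂ] U) :
    sliceR f (TensorProduct.map a LinearMap.id t) = a (sliceR f t) := by
  induction t with
  | zero => simp
  | tmul w u => simp
  | add x y hx hy => simp [hx, hy]

lemma exists_J [FiniteDimensional ℂ W] [Nontrivial W] [FiniteDimensional ℂ U]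
    (O : Set (Module.End ℂ W)) (P : Module.End ℂ W)
    (hO : ∀ N : Submodule ℂ W, (∀ a ∈ O, ∀ m ∈ N, a m ∈ N) → (∀ m ∈ N, P m ∈ N) →
      N = ⊥ ∨ N = ⊤)
    (K : Module.End ℂ (W ⊗[ℂ] U)) (hK0 : K ≠ 0)
    (hKO : ∀ a ∈ O, ∀ t, K (TensorProduct.map a LinearMap.id t)
      = TensorProduct.map a LinearMap.id (K t))
    (hKP : ∀ t, K (TensorProduct.map P LinearMap.id t)
      = -TensorProduct.map P LinearMap.id (K t)) :
    ∃ (J : Module.End ℂ W) (c : ℂ), c ≠ 0 ∧ (∀ m, J (J m) = c • m) ∧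
      (∀ a ∈ O, ∀ m, J (a m) = a (J m)) ∧ (∀ m, J (P m) = -P (J m)) ∧
      (∀ t, K (TensorProduct.map J LinearMap.id t) = TensorProduct.map J LinearMap.id (K t)) := by
  have hirr : IrrSet (O ∪ {P}) := by
    intro N h
    exact hO N (fun a ha => h a (Or.inl ha)) (h P (Or.inr rfl))
  let C : Set (Module.End ℂ W) :=
    {J | (∀ a ∈ O, ∀ m, J (a m) = a (J m)) ∧ (∀ m, J (P m) = -P (J m))}
  have hprod : ∀ J ∈ C, ∀ J' ∈ C, ∃ c : ℂ, ∀ m, J (J' m) = c • m := by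
    intro J hJ J' hJ'
    obtain ⟨c, hc⟩ := schur_scalar hirr (J ∘ₗ J') (by
      rintro a (ha | rfl) m
      · simp only [LinearMap.comp_apply, hJ'.1 a ha, hJ.1 a ha]
      · simp only [LinearMap.comp_apply, hJ'.2, map_neg, hJ.2, neg_neg])
    exact ⟨c, hc⟩
  have hinj : ∀ J ∈ C, J ≠ 0 → ∀ m, J m = 0 → m = 0 := by
    intro J hJ hJ0
    have : LinearMap.ker J = ⊥ := by
      refine (hO (LinearMap.ker J) ?_ ?_).resolve_right ?_
      · intro a ha m hm
        rw [LinearMap.mem_ker] at hm ⊢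
        rw [hJ.1 a ha, hm, map_zero]
      · intro m hm
        rw [LinearMap.mem_ker] at hm ⊢
        rw [hJ.2, hm, map_zero, neg_zero]
      · rwa [LinearMap.ker_eq_top]
    intro m hm
    have h : m ∈ LinearMap.ker J := hm
    rw [this] at h; exact h
  let Ks : (U →ₗ[ℂ] ℂ) → U → Module.End ℂ W := fun f u =>
    sliceR f ∘ₗ K ∘ₗ (TensorProduct.mk ℂ W U).flip u
  have hKs_apply : ∀ f u w, Ks f u w = sliceR f (K (w ⊗ₜ[ℂ] u)) := fun f u w => rfl
  have hKs : ∀ f u, Ks f u ∈ C := by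
    intro f u
    constructor
    · intro a ha m
      rw [hKs_apply, hKs_apply, ← sliceR_map, ← hKO a ha]; simp
    · intro m
      rw [hKs_apply, hKs_apply, ← sliceR_map, ← map_neg, ← hKP]; simp
  have hex : ∃ f u, Ks f u ≠ 0 := by
    by_contra! hno
    apply hK0
    apply TensorProduct.ext'
    intro w u
    apply sliceR_sep
    intro f
    rw [← hKs_apply, hno]; rfl
  obtain ⟨f0, u0, hJ0⟩ := hex
  set J := Ks f0 u0 with hJdef
  have hJ : J ∈ C := hKs f0 u0
  obtain ⟨c, hc⟩ := hprod J hJ J hJ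
  have hc0 : c ≠ 0 := by
    rintro rfl
    obtain ⟨m, hm⟩ := exists_ne (0 : W)
    apply hm
    apply hinj J hJ hJ0
    apply hinj J hJ hJ0
    rw [hc, zero_smul]
  have hcomm : ∀ J' ∈ C, ∀ m, J' (J m) = J (J' m) := by
    intro J' hJ' m
    obtain ⟨d, hd⟩ := hprod J hJ J' hJ'
    have h1 : ∀ m, J' m = (c⁻¹ * d) • J m := by
      intro m
      have h2 : c • J' m = d • J m := by rw [← hc (J' m), hd, map_smul]
      rw [mul_smul, ← h2, smul_smul, inv_mul_cancel₀ hc0, one_smul]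
    rw [h1, h1, map_smul]
  refine ⟨J, c, hc0, hc, hJ.1, hJ.2, ?_⟩
  intro t
  induction t with
  | zero => simp
  | add x y hx hy => simp [hx, hy]
  | tmul w u =>
    rw [← sub_eq_zero]
    apply sliceR_sep
    intro f
    rw [map_sub, sliceR_map, sub_eq_zero]
    simp only [TensorProduct.map_tmul, LinearMap.id_apply]
    rw [← hKs_apply, ← hKs_apply]
    exact hcomm _ (hKs f u) w

end Abstract

section QSpecific

open TensorProduct

/-- multiplication of an element of `𝔮(n) ⊗ B` by a scalar of `B` -/
def bsm (a : B) (x : ↥(qA n B)) : ↥(qA n B) :=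
  ⟨(a • (x : QPair n B).1, a • (x : QPair n B).2),
    ⟨by simp [Matrix.trace_smul, x.2.1], by simp [Matrix.trace_smul, x.2.2]⟩⟩

lemma bsm_add (a b : B) (x : ↥(qA n B)) : bsm n (a + b) x = bsm n a x + bsm n b x := by
  apply Subtype.ext
  simp [bsm, add_smul]

lemma bsm_one (x : ↥(qA n B)) : bsm n (1 : B) x = x := by
  apply Subtype.ext
  simp [bsm]

lemma bsm_zero (x : ↥(qA n B)) : bsm n (0 : B) x = 0 := by
  apply Subtype.ext
  simp [bsm]

lemma bsm_mul (a b : B) (x : ↥(qA n B)) : bsm n (a * b) x = bsm n b (bsm n a x) := by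
  apply Subtype.ext
  simp [bsm, smul_smul, mul_comm]

lemma even_bsm (a : B) (x : ↥(qA n B)) :
    evenPartL n B (bsm n a x) = bsm n a (evenPartL n B x) := by
  apply Subtype.ext
  simp [bsm, evenPartL]

lemma odd_bsm (a : B) (x : ↥(qA n B)) :
    oddPartL n B (bsm n a x) = bsm n a (oddPartL n B x) := by
  apply Subtype.ext
  simp [bsm, oddPartL]

lemma even_add_odd (x : ↥(qA n B)) : evenPartL n B x + oddPartL n B x = x := by
  apply Subtype.ext
  simp [evenPartL, oddPartL]

lemma even_even (x : ↥(qA n B)) : evenPartL n B (evenPartL n B x) = evenPartL n B x := rfl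
lemma odd_odd (x : ↥(qA n B)) : oddPartL n B (oddPartL n B x) = oddPartL n B x := rfl
lemma odd_even (x : ↥(qA n B)) : oddPartL n B (evenPartL n B x) = 0 := rfl
lemma even_odd (x : ↥(qA n B)) : evenPartL n B (oddPartL n B x) = 0 := rfl

lemma isEven_even (x : ↥(qA n B)) : IsEvenElt n B (evenPartL n B x : QPair n B) := rfl
lemma isOdd_odd (x : ↥(qA n B)) : IsOddElt n B (oddPartL n B x : QPair n B) := rfl

lemma even_of_isEven {x : ↥(qA n B)} (h : IsEvenElt n B (x : QPair n B)) :
    evenPartL n B x = x ∧ oddPartL n B x = 0 := by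
  have h' : (x : QPair n B).2 = 0 := h
  constructor
  · apply Subtype.ext; apply Prod.ext
    · rfl
    · exact h'.symm
  · apply Subtype.ext; apply Prod.ext
    · rfl
    · exact h'

lemma odd_of_isOdd {x : ↥(qA n B)} (h : IsOddElt n B (x : QPair n B)) :
    oddPartL n B x = x ∧ evenPartL n B x = 0 := by
  have h' : (x : QPair n B).1 = 0 := h
  constructor
  · apply Subtype.ext; apply Prod.ext
    · exact h'.symm
    · rfl
  · apply Subtype.ext; apply Prod.ext
    · exact h'
    · rfl

variable {N : Type*} [AddCommGroup N] [Module ℂ N]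

lemma annA_act (ρ : QAct n B N) {a : B} (ha : a ∈ annA n B ρ) (x : ↥(qA n B)) :
    ρ.act (bsm n a x) = 0 := by
  let Z : Ideal B :=
    { carrier := {a | ∀ x : ↥(qA n B), ρ.act (bsm n a x) = 0}
      add_mem' := by
        intro a b ha hb x
        rw [bsm_add, map_add, ha x, hb x, add_zero]
      zero_mem' := by
        intro x
        rw [bsm_zero, map_zero]
      smul_mem' := by
        intro c a ha x
        rw [smul_eq_mul, bsm_mul]
        exact ha _ }
  have hle : annA n B ρ ≤ Z := by
    apply sSup_le
    intro I hI a ha x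
    apply hI
    intro i j
    exact ⟨by simpa [bsm] using I.mul_mem_right _ ha, by simpa [bsm] using I.mul_mem_right _ ha⟩
  exact hle ha x

variable {N1 N2 : Type} [AddCommGroup N1] [Module ℂ N1] [AddCommGroup N2] [Module ℂ N2]

/-- bundled tensor product action -/
def tensQ (ρ1 : QAct n B N1) (ρ2 : QAct n B N2) : QAct n B (N1 ⊗[ℂ] N2) where
  act :=
    { toFun := tensAct n B ρ1 ρ2
      map_add' := by
        intro x y
        simp only [tensAct, map_add, TensorProduct.map_add_left, TensorProduct.map_add_right]
        abel
      map_smul' := by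
        intro c x
        simp only [tensAct, map_smul, TensorProduct.map_smul_left, TensorProduct.map_smul_right,
          RingHom.id_apply, smul_add] }
  P := tensP n B ρ1 ρ2

lemma tensQ_act_tmul (ρ1 : QAct n B N1) (ρ2 : QAct n B N2) (x : ↥(qA n B)) (u : N1) (v : N2) :
    (tensQ n ρ1 ρ2).act x (u ⊗ₜ[ℂ] v) = ρ1.act x u ⊗ₜ[ℂ] v +
      u ⊗ₜ[ℂ] ρ2.act (evenPartL n B x) v + ρ1.P u ⊗ₜ[ℂ] ρ2.act (oddPartL n B x) v := by
  simp [tensQ, tensAct]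

lemma tensQ_P_tmul (ρ1 : QAct n B N1) (ρ2 : QAct n B N2) (u : N1) (v : N2) :
    (tensQ n ρ1 ρ2).P (u ⊗ₜ[ℂ] v) = ρ1.P u ⊗ₜ[ℂ] ρ2.P v := by
  simp [tensQ, tensP]

/-- the bracket, bundled -/
def br (x y : ↥(qA n B)) : ↥(qA n B) := ⟨qbr n B ↑x ↑y, qbr_mem n B _ _⟩

lemma br_even_left {x y : ↥(qA n B)} (h : IsEvenElt n B (x : QPair n B)) :
    evenPartL n B (br n x y) = br n x (evenPartL n B y) ∧
    oddPartL n B (br n x y) = br n x (oddPartL n B y) := by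
  have h' : (x : QPair n B).2 = 0 := h
  constructor <;> apply Subtype.ext <;>
    simp [br, evenPartL, oddPartL, qbr, h']

lemma br_even_right {x y : ↥(qA n B)} (h : IsEvenElt n B (y : QPair n B)) :
    evenPartL n B (br n x y) = br n (evenPartL n B x) y ∧
    oddPartL n B (br n x y) = br n (oddPartL n B x) y := by
  have h' : (y : QPair n B).2 = 0 := h
  constructor <;> apply Subtype.ext <;>
    simp [br, evenPartL, oddPartL, qbr, h']

lemma br_odd {x y : ↥(qA n B)} (h : IsOddElt n B (x : QPair n B))
    (k : IsOddElt n B (y : QPair n B)) :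
    IsEvenElt n B (br n x y : QPair n B) := by
  have h' : (x : QPair n B).1 = 0 := h
  have k' : (y : QPair n B).1 = 0 := k
  simp [IsEvenElt, br, qbr, h', k']

lemma tensQ_isRep (ρ1 : QAct n B N1) (ρ2 : QAct n B N2)
    (h1 : QAct.IsRep n B ρ1) (h2 : QAct.IsRep n B ρ2) : QAct.IsRep n B (tensQ n ρ1 ρ2) := by
  obtain ⟨p1, e1, o1, b1, c1⟩ := h1
  obtain ⟨p2, e2, o2, b2, c2⟩ := h2
  have p1 : ∀ m, ρ1.P (ρ1.P m) = m := fun m => LinearMap.congr_fun p1 m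
  have p2 : ∀ m, ρ2.P (ρ2.P m) = m := fun m => LinearMap.congr_fun p2 m
  have e1 : ∀ x : ↥(qA n B), IsEvenElt n B ↑x → ∀ m, ρ1.P (ρ1.act x m) = ρ1.act x (ρ1.P m) :=
    fun x hx m => LinearMap.congr_fun (e1 x hx) m
  have e2 : ∀ x : ↥(qA n B), IsEvenElt n B ↑x → ∀ m, ρ2.P (ρ2.act x m) = ρ2.act x (ρ2.P m) :=
    fun x hx m => LinearMap.congr_fun (e2 x hx) m
  have o1 : ∀ x : ↥(qA n B), IsOddElt n B ↑x → ∀ m, ρ1.P (ρ1.act x m) = -ρ1.act x (ρ1.P m) :=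
    fun x hx m => LinearMap.congr_fun (o1 x hx) m
  have o2 : ∀ x : ↥(qA n B), IsOddElt n B ↑x → ∀ m, ρ2.P (ρ2.act x m) = -ρ2.act x (ρ2.P m) :=
    fun x hx m => LinearMap.congr_fun (o2 x hx) m
  have b1 : ∀ x y : ↥(qA n B), (IsEvenElt n B ↑x ∨ IsEvenElt n B ↑y) → ∀ m,
    ρ1.act (br n x y) m = ρ1.act x (ρ1.act y m) - ρ1.act y (ρ1.act x m) :=
    fun x y h m => LinearMap.congr_fun (b1 x y h) m
  have b2 : ∀ x y : ↥(qA n B), (IsEvenElt n B ↑x ∨ IsEvenElt n B ↑y) → ∀ m,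
    ρ2.act (br n x y) m = ρ2.act x (ρ2.act y m) - ρ2.act y (ρ2.act x m) :=
    fun x y h m => LinearMap.congr_fun (b2 x y h) m
  have c1 : ∀ x y : ↥(qA n B), IsOddElt n B ↑x → IsOddElt n B ↑y → ∀ m,
    ρ1.act (br n x y) m = ρ1.act x (ρ1.act y m) + ρ1.act y (ρ1.act x m) :=
    fun x y h k m => LinearMap.congr_fun (c1 x y h k) m
  have c2 : ∀ x y : ↥(qA n B), IsOddElt n B ↑x → IsOddElt n B ↑y → ∀ m,
    ρ2.act (br n x y) m = ρ2.act x (ρ2.act y m) + ρ2.act y (ρ2.act x m) :=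
    fun x y h k m => LinearMap.congr_fun (c2 x y h k) m
  refine ⟨?_, ?_, ?_, ?_, ?_⟩
  · apply TensorProduct.ext'
    intro u v
    simp [tensQ_P_tmul, p1, p2]
  · intro x hx
    apply TensorProduct.ext'
    intro u v
    obtain ⟨k1, k2⟩ := even_of_isEven n hx
    simp [tensQ_P_tmul, tensQ_act_tmul, k1, k2, e1 x hx, e2 x hx]
  · intro x hx
    apply TensorProduct.ext'
    intro u v
    obtain ⟨k1, k2⟩ := odd_of_isOdd n hx
    simp only [tensQ_P_tmul, tensQ_act_tmul, k1, k2, o1 x hx, o2 x hx, LinearMap.comp_apply,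
      LinearMap.neg_apply, map_add, map_zero, LinearMap.zero_apply, TensorProduct.tmul_zero,
      TensorProduct.neg_tmul, TensorProduct.tmul_neg]
    abel
  · intro x y hxy
    apply TensorProduct.ext'
    intro u v
    change (tensQ n ρ1 ρ2).act (br n x y) _ = _
    rcases hxy with hx | hy
    · obtain ⟨k1, k2⟩ := even_of_isEven n hx
      obtain ⟨k3, k4⟩ := br_even_left n (y := y) hx
      simp only [tensQ_act_tmul, k1, k2, k3, k4, LinearMap.comp_apply, LinearMap.sub_apply,
        map_add, map_zero, LinearMap.zero_apply, TensorProduct.tmul_zero, add_zero,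
        b1 x _ (Or.inl hx), b2 x _ (Or.inl hx), e1 x hx,
        TensorProduct.sub_tmul, TensorProduct.tmul_sub]
      abel
    · obtain ⟨k1, k2⟩ := even_of_isEven n hy
      obtain ⟨k3, k4⟩ := br_even_right n (x := x) hy
      simp only [tensQ_act_tmul, k1, k2, k3, k4, LinearMap.comp_apply, LinearMap.sub_apply,
        map_add, map_zero, LinearMap.zero_apply, TensorProduct.tmul_zero, add_zero,
        b1 _ y (Or.inr hy), b2 _ y (Or.inr hy), e1 y hy,
        TensorProduct.sub_tmul, TensorProduct.tmul_sub]
      abel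
  · intro x y hx hy
    apply TensorProduct.ext'
    intro u v
    change (tensQ n ρ1 ρ2).act (br n x y) _ = _
    obtain ⟨k1, k2⟩ := odd_of_isOdd n hx
    obtain ⟨k3, k4⟩ := odd_of_isOdd n hy
    obtain ⟨k5, k6⟩ := even_of_isEven n (br_odd n hx hy)
    simp only [tensQ_act_tmul, k1, k2, k3, k4, k5, k6, LinearMap.comp_apply, LinearMap.add_apply,
        map_add, map_zero, LinearMap.zero_apply, TensorProduct.tmul_zero, add_zero,
        c1 x y hx hy, c2 x y hx hy, o1 x hx, o1 y hy, p1,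
        TensorProduct.add_tmul, TensorProduct.tmul_add, TensorProduct.neg_tmul]
    abel

/-- restriction of an action to an invariant subspace -/
def restrQ (ρ : QAct n B N) (S : Submodule ℂ N) (hS : QAct.Invt n B ρ S) : QAct n B S where
  act :=
    { toFun := fun x => (ρ.act x).restrict (hS.1 x)
      map_add' := by
        intro x y; ext m; simp
      map_smul' := by
        intro c x; ext m; simp }
  P := ρ.P.restrict hS.2

lemma restrQ_act (ρ : QAct n B N) (S : Submodule ℂ N) (hS : QAct.Invt n B ρ S)
    (x : ↥(qA n B)) (s : S) : ((restrQ n ρ S hS).act x s : N) = ρ.act x s := rfl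

lemma restrQ_P (ρ : QAct n B N) (S : Submodule ℂ N) (hS : QAct.Invt n B ρ S)
    (s : S) : ((restrQ n ρ S hS).P s : N) = ρ.P s := rfl

lemma restrQ_isRep (ρ : QAct n B N) (S : Submodule ℂ N) (hS : QAct.Invt n B ρ S)
    (h : QAct.IsRep n B ρ) : QAct.IsRep n B (restrQ n ρ S hS) := by
  obtain ⟨p, e, o, b, c⟩ := h
  refine ⟨?_, ?_, ?_, ?_, ?_⟩
  · ext m
    exact LinearMap.congr_fun p m
  · intro x hx
    ext m
    exact LinearMap.congr_fun (e x hx) m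
  · intro x hx
    ext m
    exact LinearMap.congr_fun (o x hx) m
  · intro x y hx
    ext m
    exact LinearMap.congr_fun (b x y hx) m
  · intro x y hx hy
    ext m
    exact LinearMap.congr_fun (c x y hx hy) m

lemma restrQ_irred (ρ : QAct n B N) (S : Submodule ℂ N) (hS : QAct.Invt n B ρ S)
    (hbot : S ≠ ⊥)
    (h : ∀ S' : Submodule ℂ N, S' ≤ S → QAct.Invt n B ρ S' → S' = ⊥ ∨ S' = S) :
    QAct.Irred n B (restrQ n ρ S hS) := by
  refine ⟨Submodule.nontrivial_iff_ne_bot.2 hbot, ?_⟩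
  intro R hR
  rcases h (R.map S.subtype) (Submodule.map_subtype_le S R) (by
    constructor
    · rintro x _ ⟨m, hm, rfl⟩
      exact ⟨_, hR.1 x m hm, rfl⟩
    · rintro _ ⟨m, hm, rfl⟩
      exact ⟨_, hR.2 m hm, rfl⟩) with h | h
  · left
    rw [eq_bot_iff]
    intro m hm
    have h3 : (m : N) ∈ R.map S.subtype := ⟨m, hm, rfl⟩
    rw [h, Submodule.mem_bot] at h3
    exact (Submodule.mem_bot ℂ).2 (Subtype.ext h3)
  · right
    rw [eq_top_iff]
    rintro ⟨m, hm⟩ _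
    rw [← h] at hm
    obtain ⟨m', hm', h'⟩ := hm
    have : m' = ⟨m, by rw [← h']; exact m'.2⟩ := Subtype.ext h'
    rwa [← this]

lemma hw_push {N' : Type*} [AddCommGroup N'] [Module ℂ N'] [Nontrivial N']
    (ρ : QAct n B N) (ρ' : QAct n B N') (π : N →ₗ[ℂ] N') (hπ : Function.Surjective π)
    (hcomm : ∀ x t, π (ρ.act x t) = ρ'.act x (π t)) (ψ : ↥(h0A n B) →ₗ[ℂ] ℂ) (v : N)
    (hgen : QAct.gen n B ρ v = ⊤)
    (hn : ∀ x : ↥(qA n B), InNplus n B ↑x → ρ.act x v = 0)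
    (hh : ∀ (p : QPair n B) (hp : p ∈ h0A n B),
      ρ.act ⟨p, h0A_le_qA n B hp⟩ v = ψ ⟨p, hp⟩ • v) :
    QAct.IsHWVector n B ρ' ψ (π v) := by
  have key : ∀ S : Submodule ℂ N', π v ∈ S → (∀ x : ↥(qA n B), ∀ m ∈ S, ρ'.act x m ∈ S) →
      S = ⊤ := by
    intro S hv hS
    have h1 : QAct.gen n B ρ v ≤ S.comap π := by
      apply sInf_le
      refine ⟨hv, ?_⟩
      intro x m hm
      rw [Submodule.mem_comap] at hm ⊢
      rw [hcomm]
      exact hS x _ hm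
    rw [hgen] at h1
    rw [eq_top_iff]
    intro m _
    obtain ⟨t, rfl⟩ := hπ m
    exact h1 trivial
  refine ⟨?_, ?_, ?_, ?_⟩
  · intro h0
    have := key ⊥ (by rw [h0]; exact Submodule.zero_mem _) (by
      intro x m hm
      rw [Submodule.mem_bot] at hm ⊢
      rw [hm, map_zero])
    exact bot_ne_top this
  · rw [eq_top_iff]
    apply le_sInf
    rintro S ⟨hv, hS⟩
    rw [key S hv hS]
  · intro x hx
    rw [← hcomm, hn x hx, map_zero]
  · intro p hp
    rw [← hcomm, hh p hp, map_smul]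

end QSpecific

section Final

open TensorProduct

variable {N1 N2 : Type} [AddCommGroup N1] [Module ℂ N1] [AddCommGroup N2] [Module ℂ N2]

lemma split_actions (ρ1 : QAct n B N1) (ρ2 : QAct n B N2)
    (hdisj : ∀ m : Ideal B, m.IsMaximal → ¬ (annA n B ρ1 ≤ m ∧ annA n B ρ2 ≤ m)) :
    (∀ x, ∃ y, (tensQ n ρ1 ρ2).act y = TensorProduct.map (ρ1.act x) LinearMap.id) ∧
    (∀ x, ∃ y, (tensQ n ρ1 ρ2).act y =
      TensorProduct.map LinearMap.id (ρ2.act (evenPartL n B x)) +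
      TensorProduct.map ρ1.P (ρ2.act (oddPartL n B x))) := by
  have htop : annA n B ρ1 ⊔ annA n B ρ2 = ⊤ := by
    by_contra hne
    obtain ⟨m, hm, hle⟩ := Ideal.exists_le_maximal _ hne
    exact hdisj m hm ⟨le_sup_left.trans hle, le_sup_right.trans hle⟩
  have h1 : (1 : B) ∈ annA n B ρ1 ⊔ annA n B ρ2 := by rw [htop]; trivial
  obtain ⟨a, ha, b, hb, hab⟩ := Submodule.mem_sup.1 h1
  have hx1 : ∀ x, ρ1.act (bsm n b x) = ρ1.act x := by
    intro x
    conv_rhs => rw [← bsm_one n x, ← hab, bsm_add, map_add, annA_act n ρ1 ha, zero_add]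
  have hx2 : ∀ x, ρ2.act (bsm n a x) = ρ2.act x := by
    intro x
    conv_rhs => rw [← bsm_one n x, ← hab, bsm_add, map_add, annA_act n ρ2 hb, add_zero]
  constructor
  · intro x
    refine ⟨bsm n b x, ?_⟩
    change tensAct n B ρ1 ρ2 _ = _
    simp only [tensAct, even_bsm, odd_bsm, hx1, annA_act n ρ2 hb, TensorProduct.map_zero_right,
      add_zero]
  · intro x
    refine ⟨bsm n a x, ?_⟩
    change tensAct n B ρ1 ρ2 _ = _
    simp only [tensAct, even_bsm, odd_bsm, hx2, annA_act n ρ1 ha, TensorProduct.map_zero_left,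
      zero_add]

/-- the generating operators on the tensor product -/
def genOps (ρ1 : QAct n B N1) (ρ2 : QAct n B N2) : Set (Module.End ℂ (N1 ⊗[ℂ] N2)) :=
  {g | (∃ x, g = TensorProduct.map (ρ1.act (evenPartL n B x)) LinearMap.id) ∨
    (∃ x, g = TensorProduct.map (ρ1.act (oddPartL n B x)) LinearMap.id) ∨
    (∃ x, g = TensorProduct.map LinearMap.id (ρ2.act (evenPartL n B x))) ∨
    (∃ x, g = TensorProduct.map ρ1.P (ρ2.act (oddPartL n B x))) ∨
    g = TensorProduct.map ρ1.P ρ2.P}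

lemma act_decomp (ρ1 : QAct n B N1) (ρ2 : QAct n B N2) (x : ↥(qA n B)) (t : N1 ⊗[ℂ] N2) :
    (tensQ n ρ1 ρ2).act x t =
      TensorProduct.map (ρ1.act (evenPartL n B x)) LinearMap.id t +
      TensorProduct.map (ρ1.act (oddPartL n B x)) LinearMap.id t +
      TensorProduct.map LinearMap.id (ρ2.act (evenPartL n B x)) t +
      TensorProduct.map ρ1.P (ρ2.act (oddPartL n B x)) t := by
  have : ρ1.act x = ρ1.act (evenPartL n B x) + ρ1.act (oddPartL n B x) := by
    rw [← map_add, even_add_odd]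
  change tensAct n B ρ1 ρ2 x t = _
  simp only [tensAct, this, TensorProduct.map_add_left, LinearMap.add_apply]

lemma invt_iff (ρ1 : QAct n B N1) (ρ2 : QAct n B N2)
    (hdisj : ∀ m : Ideal B, m.IsMaximal → ¬ (annA n B ρ1 ≤ m ∧ annA n B ρ2 ≤ m))
    (S : Submodule ℂ (N1 ⊗[ℂ] N2)) :
    QAct.Invt n B (tensQ n ρ1 ρ2) S ↔ ∀ g ∈ genOps n ρ1 ρ2, ∀ t ∈ S, g t ∈ S := by
  obtain ⟨hL, hR⟩ := split_actions n ρ1 ρ2 hdisj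
  constructor
  · intro h g hg t ht
    rcases hg with ⟨x, rfl⟩ | ⟨x, rfl⟩ | ⟨x, rfl⟩ | ⟨x, rfl⟩ | rfl
    · obtain ⟨y, hy⟩ := hL (evenPartL n B x)
      rw [← hy]; exact h.1 y t ht
    · obtain ⟨y, hy⟩ := hL (oddPartL n B x)
      rw [← hy]; exact h.1 y t ht
    · obtain ⟨y, hy⟩ := hR (evenPartL n B x)
      rw [even_even, odd_even, map_zero, TensorProduct.map_zero_right, add_zero] at hy
      rw [← hy]; exact h.1 y t ht
    · obtain ⟨y, hy⟩ := hR (oddPartL n B x)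
      rw [odd_odd, even_odd, map_zero, TensorProduct.map_zero_right, zero_add] at hy
      rw [← hy]; exact h.1 y t ht
    · exact h.2 t ht
  · intro h
    constructor
    · intro x t ht
      rw [act_decomp]
      refine S.add_mem (S.add_mem (S.add_mem ?_ ?_) ?_) ?_
      · exact h _ (Or.inl ⟨x, rfl⟩) t ht
      · exact h _ (Or.inr (Or.inl ⟨x, rfl⟩)) t ht
      · exact h _ (Or.inr (Or.inr (Or.inl ⟨x, rfl⟩))) t ht
      · exact h _ (Or.inr (Or.inr (Or.inr (Or.inl ⟨x, rfl⟩)))) t ht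
    · intro t ht
      exact h _ (Or.inr (Or.inr (Or.inr (Or.inr rfl)))) t ht

lemma gen_tensor (ρ1 : QAct n B N1) (ρ2 : QAct n B N2) (h1rep : QAct.IsRep n B ρ1)
    (hdisj : ∀ m : Ideal B, m.IsMaximal → ¬ (annA n B ρ1 ≤ m ∧ annA n B ρ2 ≤ m))
    (v1 : N1) (v2 : N2) (h1 : QAct.gen n B ρ1 v1 = ⊤) (h2 : QAct.gen n B ρ2 v2 = ⊤) :
    QAct.gen n B (tensQ n ρ1 ρ2) (v1 ⊗ₜ[ℂ] v2) = ⊤ := by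
  obtain ⟨hL, hR⟩ := split_actions n ρ1 ρ2 hdisj
  rw [eq_top_iff]
  apply le_sInf
  rintro S ⟨hv, hS⟩
  have hS1 : ∀ x t, t ∈ S → TensorProduct.map (ρ1.act x) LinearMap.id t ∈ S := by
    intro x t ht
    obtain ⟨y, hy⟩ := hL x
    rw [← hy]; exact hS y t ht
  have hS2 : ∀ x t, t ∈ S → TensorProduct.map LinearMap.id (ρ2.act (evenPartL n B x)) t ∈ S := by
    intro x t ht
    obtain ⟨y, hy⟩ := hR (evenPartL n B x)
    rw [even_even, odd_even, map_zero, TensorProduct.map_zero_right, add_zero] at hy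
    rw [← hy]; exact hS y t ht
  have hS3 : ∀ x t, t ∈ S → TensorProduct.map ρ1.P (ρ2.act (oddPartL n B x)) t ∈ S := by
    intro x t ht
    obtain ⟨y, hy⟩ := hR (oddPartL n B x)
    rw [odd_odd, even_odd, map_zero, TensorProduct.map_zero_right, zero_add] at hy
    rw [← hy]; exact hS y t ht
  have hP : ∀ m, ρ1.P (ρ1.P m) = m := fun m => LinearMap.congr_fun h1rep.1 m
  have step1 : ∀ w, w ⊗ₜ[ℂ] v2 ∈ S := by
    have : QAct.gen n B ρ1 v1 ≤ S.comap ((TensorProduct.mk ℂ N1 N2).flip v2) := by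
      apply sInf_le
      refine ⟨hv, ?_⟩
      intro x m hm
      simpa using hS1 x _ hm
    intro w
    rw [h1] at this
    exact this (x := w) trivial
  let R : Submodule ℂ N2 :=
    { carrier := {u | ∀ w : N1, w ⊗ₜ[ℂ] u ∈ S}
      add_mem' := by
        intro u u' hu hu' w
        rw [TensorProduct.tmul_add]; exact S.add_mem (hu w) (hu' w)
      zero_mem' := by intro w; simp
      smul_mem' := by
        intro c u hu w
        rw [TensorProduct.tmul_smul]; exact S.smul_mem c (hu w) }
  have hRt : QAct.gen n B ρ2 v2 ≤ R := by
    apply sInf_le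
    refine ⟨step1, ?_⟩
    intro x u hu w
    have k1 := hS2 x _ (hu w)
    have k2 := hS3 x _ (hu (ρ1.P w))
    rw [TensorProduct.map_tmul, LinearMap.id_apply] at k1
    rw [TensorProduct.map_tmul, hP] at k2
    have : ρ2.act x u = ρ2.act (evenPartL n B x) u + ρ2.act (oddPartL n B x) u := by
      rw [← LinearMap.add_apply, ← map_add, even_add_odd]
    rw [this, TensorProduct.tmul_add]
    exact S.add_mem k1 k2
  rw [h2] at hRt
  intro t _
  induction t with
  | zero => exact S.zero_mem
  | tmul w u => exact hRt (x := u) trivial w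
  | add x y hx hy => exact S.add_mem (hx trivial) (hy trivial)

lemma genOps_sigma (ρ1 : QAct n B N1) (ρ2 : QAct n B N2) (h1rep : QAct.IsRep n B ρ1) :
    ∀ g ∈ genOps n ρ1 ρ2,
      (∀ t, TensorProduct.map ρ1.P LinearMap.id (g t) =
        g (TensorProduct.map ρ1.P LinearMap.id t)) ∨
      (∀ t, TensorProduct.map ρ1.P LinearMap.id (g t) =
        -g (TensorProduct.map ρ1.P LinearMap.id t)) := by
  obtain ⟨-, e1, o1, -, -⟩ := h1rep
  intro g hg
  rcases hg with ⟨x, rfl⟩ | ⟨x, rfl⟩ | ⟨x, rfl⟩ | ⟨x, rfl⟩ | rfl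
  · left
    intro t
    rw [← LinearMap.comp_apply, ← TensorProduct.map_comp, e1 _ (isEven_even n x),
      TensorProduct.map_comp, LinearMap.comp_apply]
  · right
    intro t
    have : TensorProduct.map (-(ρ1.act (oddPartL n B x) ∘ₗ ρ1.P)) (LinearMap.id : N2 →ₗ[ℂ] N2)
      = -TensorProduct.map (ρ1.act (oddPartL n B x) ∘ₗ ρ1.P) LinearMap.id := by
      ext; simp [TensorProduct.neg_tmul]
    rw [← LinearMap.comp_apply, ← TensorProduct.map_comp, o1 _ (isOdd_odd n x),
      LinearMap.id_comp, this, LinearMap.neg_apply]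
    congr 1
    change _ = (TensorProduct.map (ρ1.act (oddPartL n B x)) LinearMap.id ∘ₗ
      TensorProduct.map ρ1.P LinearMap.id) t
    rw [← TensorProduct.map_comp, LinearMap.id_comp]
  all_goals
    left
    intro t
    simp only [← LinearMap.comp_apply, ← TensorProduct.map_comp, LinearMap.comp_id,
      LinearMap.id_comp]

lemma irrSet_of_irred {N : Type*} [AddCommGroup N] [Module ℂ N] (ρ : QAct n B N)
    (h : QAct.Irred n B ρ) : IrrSet (Set.range ρ.act ∪ {ρ.P}) := by
  intro S hS
  exact h.2 S ⟨fun x m hm => hS _ (Or.inl ⟨x, rfl⟩) m hm, fun m hm => hS _ (Or.inr rfl) m hm⟩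

lemma genOps_full [FiniteDimensional ℂ N1] (ρ1 : QAct n B N1) (ρ2 : QAct n B N2)
    (h1rep : QAct.IsRep n B ρ1)
    (h1irr : QAct.Irred n B ρ1) (h2irr : QAct.Irred n B ρ2)
    (S : Submodule ℂ (N1 ⊗[ℂ] N2)) (hS : ∀ g ∈ genOps n ρ1 ρ2, ∀ t ∈ S, g t ∈ S)
    (hσ : ∀ t ∈ S, TensorProduct.map ρ1.P LinearMap.id t ∈ S) : S = ⊥ ∨ S = ⊤ := by
  haveI := h1irr.1
  have hP : ρ1.P ∘ₗ ρ1.P = LinearMap.id := h1rep.1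
  apply outer_irr (irrSet_of_irred n ρ1 h1irr) (irrSet_of_irred n ρ2 h2irr)
  · rintro a (⟨x, rfl⟩ | rfl) t ht
    · have : ρ1.act x = ρ1.act (evenPartL n B x) + ρ1.act (oddPartL n B x) := by
        rw [← map_add, even_add_odd]
      rw [this, TensorProduct.map_add_left]
      exact S.add_mem (hS _ (Or.inl ⟨x, rfl⟩) t ht) (hS _ (Or.inr (Or.inl ⟨x, rfl⟩)) t ht)
    · exact hσ t ht
  · rintro a (⟨x, rfl⟩ | rfl) t ht
    · have : ρ2.act x = ρ2.act (evenPartL n B x) + ρ2.act (oddPartL n B x) := by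
        rw [← map_add, even_add_odd]
      rw [this, TensorProduct.map_add_right]
      refine S.add_mem (hS _ (Or.inr (Or.inr (Or.inl ⟨x, rfl⟩))) t ht) ?_
      have h := hσ _ (hS _ (Or.inr (Or.inr (Or.inr (Or.inl ⟨x, rfl⟩)))) t ht)
      rwa [← LinearMap.comp_apply, ← TensorProduct.map_comp, hP, LinearMap.id_comp] at h
    · have h := hσ _ (hS _ (Or.inr (Or.inr (Or.inr (Or.inr rfl)))) t ht)
      rwa [← LinearMap.comp_apply, ← TensorProduct.map_comp, hP, LinearMap.id_comp] at h

/-- An involution `K` together with an anticommuting `φ`, `φ² = c ≠ 0`, splits the space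
into two isomorphic halves. -/
lemma halves {T : Type*} [AddCommGroup T] [Module ℂ T] (S : Submodule ℂ T)
    (K φ : Module.End ℂ T) (c : ℂ) (hc : c ≠ 0) (hK : ∀ t, K (K t) = t)
    (hS : ∀ t, t ∈ S ↔ K t = t) (hφ : ∀ t, φ (φ t) = c • t) (hKφ : ∀ t, K (φ t) = -φ (K t)) :
    ∃ (π : T →ₗ[ℂ] S) (e : T ≃ₗ[ℂ] S × S), Function.Surjective π ∧
      (∀ t, (π t : T) = (1 / 2 : ℂ) • (t + K t)) ∧ ∀ t, e t = (π t, π (φ t)) := by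
  let π : T →ₗ[ℂ] S := LinearMap.codRestrict S ((1 / 2 : ℂ) • (LinearMap.id + K)) (by
    intro t
    rw [hS]
    simp [hK, add_comm])
  have hπ : ∀ t, (π t : T) = (1 / 2 : ℂ) • (t + K t) := fun t => rfl
  have hπS : ∀ s : S, π s = s := by
    intro s
    apply Subtype.ext
    rw [hπ, (hS s).1 s.2, ← two_smul ℂ, smul_smul]; norm_num
  have hπφ : ∀ s : S, π (φ s) = 0 := by
    intro s
    apply Subtype.ext
    rw [hπ, hKφ, (hS s).1 s.2]; simp
  let e : T ≃ₗ[ℂ] S × S := LinearEquiv.ofLinearMap (LinearMap.prod π (π ∘ₗ φ))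
    (LinearMap.coprod S.subtype (c⁻¹ • (φ ∘ₗ S.subtype)))
    (by
      apply LinearMap.ext
      rintro ⟨a, b⟩
      have h1 : π (c⁻¹ • φ (φ b)) = b := by
        rw [hφ, smul_smul, inv_mul_cancel₀ hc, one_smul, hπS]
      rw [map_smul] at h1
      simp [hπS, hπφ, h1])
    (by
      apply LinearMap.ext
      intro t
      have h1 : φ ((π (φ t) : S) : T) = (1 / 2 : ℂ) • (c • t - c • K t) := by
        rw [hπ, hKφ, map_smul, map_add, map_neg, hφ, hφ, sub_eq_add_neg]
      change (π t : T) + c⁻¹ • φ ((π (φ t) : S) : T) = t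
      rw [h1, hπ]
      rw [← smul_sub, smul_comm (1 / 2 : ℂ) c, smul_smul c⁻¹ c, inv_mul_cancel₀ hc, one_smul,
        ← smul_add, add_add_sub_cancel, ← two_smul ℂ, smul_smul]
      norm_num)
  exact ⟨π, e, fun s => ⟨s, hπS s⟩, hπ, fun t => rfl⟩

end Final

/-- Let `V(ψ₁)`, `V(ψ₂)` be irreducible finite-dimensional highest weight
`𝔮(n) ⊗ A`-modules with disjoint supports (no maximal ideal contains both of their
annihilators).  Then `V(ψ₁) ⊗ V(ψ₂)`, with the diagonal super action, is isomorphic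
either to `V(ψ₁ + ψ₂)` or to `V(ψ₁ + ψ₂) ⊕ V(ψ₁ + ψ₂)`, where `V(ψ₁ + ψ₂)` is an
irreducible highest weight module of highest weight `ψ₁ + ψ₂`. -/
theorem tensor_disjoint_supports (hn : 2 ≤ n)
    {N1 N2 : Type} [AddCommGroup N1] [Module ℂ N1] [AddCommGroup N2] [Module ℂ N2]
    [FiniteDimensional ℂ N1] [FiniteDimensional ℂ N2]
    (ρ1 : QAct n B N1) (ρ2 : QAct n B N2)
    (h1rep : QAct.IsRep n B ρ1) (h2rep : QAct.IsRep n B ρ2)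
    (h1irr : QAct.Irred n B ρ1) (h2irr : QAct.Irred n B ρ2)
    (ψ1 ψ2 : ↥(h0A n B) →ₗ[ℂ] ℂ) (hψ1 : LFun n B ψ1) (hψ2 : LFun n B ψ2)
    (v1 : N1) (v2 : N2)
    (hv1 : QAct.IsHWVector n B ρ1 ψ1 v1) (hv2 : QAct.IsHWVector n B ρ2 ψ2 v2)
    (hdisj : ∀ m : Ideal B, m.IsMaximal → ¬ (annA n B ρ1 ≤ m ∧ annA n B ρ2 ≤ m)) :
    ∃ V : QModB n B, QAct.IsRep n B V.ρ ∧ QAct.Irred n B V.ρ ∧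
      (∃ v3 : V.M, QAct.IsHWVector n B V.ρ (ψ1 + ψ2) v3) ∧
      ((∃ e : (N1 ⊗[ℂ] N2) ≃ₗ[ℂ] V.M,
          ∀ (x : ↥(qA n B)) (t : N1 ⊗[ℂ] N2),
            e (tensAct n B ρ1 ρ2 x t) = V.ρ.act x (e t)) ∨
        (∃ e : (N1 ⊗[ℂ] N2) ≃ₗ[ℂ] V.M × V.M,
          ∀ (x : ↥(qA n B)) (t : N1 ⊗[ℂ] N2),
            e (tensAct n B ρ1 ρ2 x t) =
              (V.ρ.act x (e t).1, V.ρ.act x (e t).2))) := by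
  haveI := h1irr.1
  haveI := h2irr.1
  have hTrep := tensQ_isRep n ρ1 ρ2 h1rep h2rep
  have hgen := gen_tensor n ρ1 ρ2 h1rep hdisj v1 v2 hv1.2.1 hv2.2.1
  have hnp : ∀ x : ↥(qA n B), InNplus n B ↑x → (tensQ n ρ1 ρ2).act x (v1 ⊗ₜ[ℂ] v2) = 0 := by
    intro x hx
    have h1 : InNplus n B (evenPartL n B x : QPair n B) :=
      fun i j hij => ⟨(hx i j hij).1, rfl⟩
    have h2 : InNplus n B (oddPartL n B x : QPair n B) :=
      fun i j hij => ⟨rfl, (hx i j hij).2⟩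
    rw [tensQ_act_tmul, hv1.2.2.1 x hx, hv2.2.2.1 _ h1, hv2.2.2.1 _ h2]
    simp
  have hh : ∀ (p : QPair n B) (hp : p ∈ h0A n B),
      (tensQ n ρ1 ρ2).act ⟨p, h0A_le_qA n B hp⟩ (v1 ⊗ₜ[ℂ] v2) =
        (ψ1 + ψ2) ⟨p, hp⟩ • (v1 ⊗ₜ[ℂ] v2) := by
    intro p hp
    obtain ⟨k1, k2⟩ := even_of_isEven n (x := ⟨p, h0A_le_qA n B hp⟩) hp.1
    rw [tensQ_act_tmul, k1, k2, hv1.2.2.2 p hp, hv2.2.2.2 p hp]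
    simp [add_smul, TensorProduct.smul_tmul']
  have hTnt : Nontrivial (N1 ⊗[ℂ] N2) := by
    infer_instance
  by_cases hirr : QAct.Irred n B (tensQ n ρ1 ρ2)
  · refine ⟨⟨N1 ⊗[ℂ] N2, tensQ n ρ1 ρ2⟩, hTrep, hirr, ⟨v1 ⊗ₜ[ℂ] v2, ?_⟩, Or.inl ?_⟩
    · exact hw_push n (tensQ n ρ1 ρ2) (tensQ n ρ1 ρ2) LinearMap.id Function.surjective_id
        (fun _ _ => rfl) _ _ hgen hnp hh
    · exact ⟨LinearEquiv.refl ℂ _, fun _ _ => rfl⟩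
  have hex : ∃ S : Submodule ℂ (N1 ⊗[ℂ] N2), QAct.Invt n B (tensQ n ρ1 ρ2) S ∧
      S ≠ ⊥ ∧ S ≠ ⊤ := by
    by_contra! hno
    apply hirr
    refine ⟨hTnt, fun S hS => ?_⟩
    by_cases hb : S = ⊥
    · exact Or.inl hb
    · exact Or.inr (hno S hS hb)
  obtain ⟨S, hS, hSb, hSt⟩ := hex
  have hP1 : ρ1.P ∘ₗ ρ1.P = LinearMap.id := h1rep.1
  have hP2 : ρ2.P ∘ₗ ρ2.P = LinearMap.id := h2rep.1
  have hσ : ∀ t : N1 ⊗[ℂ] N2, TensorProduct.map ρ1.P LinearMap.id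
      (TensorProduct.map ρ1.P LinearMap.id t) = t := by
    intro t
    rw [← LinearMap.comp_apply, ← TensorProduct.map_comp, hP1, LinearMap.id_comp,
      TensorProduct.map_id, LinearMap.id_apply]
  obtain ⟨⟨K, hKK, hKG, hKσ, hKS⟩, hmin⟩ := clifford_abstract
    (TensorProduct.map ρ1.P LinearMap.id) hσ (genOps n ρ1 ρ2) (genOps_sigma n ρ1 ρ2 h1rep)
    (genOps_full n ρ1 ρ2 h1rep h1irr h2irr) S ((invt_iff n ρ1 ρ2 hdisj S).1 hS) hSb hSt
  have hK0 : K ≠ 0 := by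
    rintro rfl
    obtain ⟨t, ht⟩ := exists_ne (0 : N1 ⊗[ℂ] N2)
    exact ht (by simpa using (hKK t).symm)
  have hKact : ∀ x t, K ((tensQ n ρ1 ρ2).act x t) = (tensQ n ρ1 ρ2).act x (K t) := by
    intro x t
    rw [act_decomp, act_decomp]
    simp only [map_add]
    rw [hKG _ (Or.inl ⟨x, rfl⟩), hKG _ (Or.inr (Or.inl ⟨x, rfl⟩)),
      hKG _ (Or.inr (Or.inr (Or.inl ⟨x, rfl⟩))),
      hKG _ (Or.inr (Or.inr (Or.inr (Or.inl ⟨x, rfl⟩))))]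
  have hKact1 : ∀ a ∈ Set.range ρ1.act, ∀ t, K (TensorProduct.map a LinearMap.id t)
      = TensorProduct.map a LinearMap.id (K t) := by
    rintro _ ⟨x, rfl⟩ t
    obtain ⟨y, hy⟩ := (split_actions n ρ1 ρ2 hdisj).1 x
    rw [← hy]; exact hKact y t
  obtain ⟨J, c, hc, hJJ, hJO, hJP, hJK⟩ := exists_J (Set.range ρ1.act) ρ1.P
    (fun R h1 h2 => h1irr.2 R ⟨fun x m hm => h1 _ ⟨x, rfl⟩ m hm, h2⟩) K hK0 hKact1 hKσ
  let φ : Module.End ℂ (N1 ⊗[ℂ] N2) := TensorProduct.map J ρ2.P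
  have hφtm : ∀ u w, φ (u ⊗ₜ[ℂ] w) = J u ⊗ₜ[ℂ] ρ2.P w := fun u w => rfl
  have hp1 : ∀ m, ρ1.P (ρ1.P m) = m := fun m => LinearMap.congr_fun hP1 m
  have hp2 : ∀ m, ρ2.P (ρ2.P m) = m := fun m => LinearMap.congr_fun hP2 m
  have hφφ : ∀ t, φ (φ t) = c • t := by
    intro t
    induction t with
    | zero => simp
    | tmul u w => rw [hφtm, hφtm, hJJ, hp2, TensorProduct.smul_tmul']
    | add x y hx hy => rw [map_add, map_add, hx, hy, smul_add]
  have hφact : ∀ x t, φ ((tensQ n ρ1 ρ2).act x t) = (tensQ n ρ1 ρ2).act x (φ t) := by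
    intro x t
    have he : ∀ w, ρ2.P (ρ2.act (evenPartL n B x) w) = ρ2.act (evenPartL n B x) (ρ2.P w) :=
      fun w => LinearMap.congr_fun (h2rep.2.1 _ (isEven_even n x)) w
    have ho : ∀ w, ρ2.P (ρ2.act (oddPartL n B x) w) = -ρ2.act (oddPartL n B x) (ρ2.P w) :=
      fun w => LinearMap.congr_fun (h2rep.2.2.1 _ (isOdd_odd n x)) w
    induction t with
    | zero => simp
    | tmul u w =>
      rw [hφtm, tensQ_act_tmul, tensQ_act_tmul, map_add, map_add, hφtm, hφtm, hφtm,
        hJO _ ⟨x, rfl⟩, hJP, he, ho, TensorProduct.neg_tmul, TensorProduct.tmul_neg, neg_neg]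
    | add x y hx hy => simp only [map_add, hx, hy]
  have hK1P : ∀ t, K (TensorProduct.map LinearMap.id ρ2.P t)
      = -TensorProduct.map LinearMap.id ρ2.P (K t) := by
    have h1 : ∀ t : N1 ⊗[ℂ] N2, TensorProduct.map LinearMap.id ρ2.P t =
        TensorProduct.map ρ1.P LinearMap.id (TensorProduct.map ρ1.P ρ2.P t) := by
      intro t
      rw [← LinearMap.comp_apply, ← TensorProduct.map_comp, hP1, LinearMap.id_comp]
    intro t
    rw [h1, h1, hKσ, hKG _ (Or.inr (Or.inr (Or.inr (Or.inr rfl))))]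
  have hKφ : ∀ t, K (φ t) = -φ (K t) := by
    have h1 : ∀ t : N1 ⊗[ℂ] N2, φ t =
        TensorProduct.map J LinearMap.id (TensorProduct.map LinearMap.id ρ2.P t) := by
      intro t
      rw [← LinearMap.comp_apply, ← TensorProduct.map_comp, LinearMap.comp_id, LinearMap.id_comp]
    intro t
    rw [h1, h1, hJK, hK1P, map_neg]
  obtain ⟨π, e, hπs, hπ, he⟩ := halves S K φ c hc hKK hKS hφφ hKφ
  have hπact : ∀ x t, π ((tensQ n ρ1 ρ2).act x t) =
      (restrQ n (tensQ n ρ1 ρ2) S hS).act x (π t) := by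
    intro x t
    apply Subtype.ext
    rw [restrQ_act, hπ, hπ, hKact, map_smul, map_add]
  haveI : Nontrivial S := Submodule.nontrivial_iff_ne_bot.2 hSb
  refine ⟨⟨S, restrQ n (tensQ n ρ1 ρ2) S hS⟩, restrQ_isRep n _ S hS hTrep, ?_,
    ⟨π (v1 ⊗ₜ[ℂ] v2), ?_⟩, Or.inr ⟨e, ?_⟩⟩
  · exact restrQ_irred n _ S hS hSb
      (fun S' hle h => hmin S' hle ((invt_iff n ρ1 ρ2 hdisj S').1 h))
  · exact hw_push n (tensQ n ρ1 ρ2) (restrQ n (tensQ n ρ1 ρ2) S hS) π hπs hπact _ _ hgen hnp hh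
  · intro x t
    change e ((tensQ n ρ1 ρ2).act x t) = _
    rw [he, he, hφact, hπact, hπact]
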